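/- arXiv:2307.11372 — 3 statements merged into one kernel-verified Lean document; each statement's English description precedes it below -/
import Mathlib

section
/- Let Φ : 𝒫 → 𝒫 be a support-preserving multiplicative map. Then there exists a real constant γ > 0 such that for every p ∈ 𝒫, Φ[p] is the polynomial x ↦ p(γx)/p(γ); that is, Φ[p] = (1/p(γ)) · p∘(γX). -/
open Polynomial

/-- `Pset` is the set of real polynomials with nonnegative coefficients summing to 1. -/
def Pset : Set (Polynomial ℝ) := {p | (∀ k, 0 ≤ p.coeff k) ∧ p.eval 1 = 1}

/-- The polynomials with nonnegative coefficients and constant coefficient `1`. -/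
def UnitCone : Set (Polynomial ℝ) := {p | (∀ k, 0 ≤ p.coeff k) ∧ p.coeff 0 = 1}

theorem coeff_mul_nonneg {p q : Polynomial ℝ} (hp : ∀ k, 0 ≤ p.coeff k)
    (hq : ∀ k, 0 ≤ q.coeff k) (k : ℕ) : 0 ≤ (p * q).coeff k := by
  rw [coeff_mul]
  exact Finset.sum_nonneg fun x _ => mul_nonneg (hp _) (hq _)

theorem coeff_le_eval_one {p : Polynomial ℝ} (hp : ∀ k, 0 ≤ p.coeff k) (k : ℕ) :
    p.coeff k ≤ p.eval 1 := by
  rw [eval_eq_sum_range]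
  simp only [one_pow, mul_one]
  by_cases hk : k ≤ p.natDegree
  · exact Finset.single_le_sum (f := fun i => p.coeff i) (fun i _ => hp i)
      (Finset.mem_range.2 (by omega))
  · rw [coeff_eq_zero_of_natDegree_lt (by omega)]
    exact Finset.sum_nonneg fun i _ => hp i

theorem mul_mem_unitCone {p q : Polynomial ℝ} (hp : p ∈ UnitCone) (hq : q ∈ UnitCone) :
    p * q ∈ UnitCone :=
  ⟨coeff_mul_nonneg hp.1 hq.1, by rw [mul_coeff_zero, hp.2, hq.2, one_mul]⟩

theorem one_add_monomial_mem_unitCone {k : ℕ} (hk : k ≠ 0) {b : ℝ} (hb : 0 ≤ b) :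
    1 + monomial k b ∈ UnitCone := by
  refine ⟨fun j => ?_, ?_⟩
  · rw [coeff_add, coeff_one, coeff_monomial]
    split_ifs <;> positivity
  · rw [coeff_add, coeff_one, coeff_monomial, if_pos rfl, if_neg hk, add_zero]

theorem coeff_mul_of_gap {p q : Polynomial ℝ} {k : ℕ} (hk : k ≠ 0) (hp : p.coeff 0 = 1)
    (hq : q.coeff 0 = 1) (hgap : ∀ j, 0 < j → j < k → q.coeff j = 0) :
    (p * q).coeff k = p.coeff k + q.coeff k := by
  rw [coeff_mul, Finset.sum_eq_add_of_mem (k, 0) (0, k) (by simp) (by simp) (by simp [hk])]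
  · simp [hp, hq]
  · rintro ⟨i, j⟩ hij ⟨h1, h2⟩
    rw [Finset.HasAntidiagonal.mem_antidiagonal] at hij
    simp only [ne_eq, Prod.mk.injEq, not_and] at h1 h2
    rw [hgap j (by omega) (by omega), mul_zero]

/-- The multiplier `1 - b X ^ k + c (X ^ (k + 1) + ⋯ + X ^ M)`. -/
noncomputable def killer (k M : ℕ) (b c : ℝ) : Polynomial ℝ :=
  1 - C b * X ^ k + C c * ∑ i ∈ Finset.Ioc k M, X ^ i

theorem coeff_mul_killer (p : Polynomial ℝ) (k M : ℕ) (b c : ℝ) (j : ℕ) :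
    (p * killer k M b c).coeff j = p.coeff j - b * (if k ≤ j then p.coeff (j - k) else 0)
      + c * ∑ i ∈ Finset.Ioc k M, if i ≤ j then p.coeff (j - i) else 0 := by
  have h : p * killer k M b c
      = p - C b * (p * X ^ k) + C c * ∑ i ∈ Finset.Ioc k M, p * X ^ i := by
    rw [killer, ← Finset.mul_sum]
    ring
  rw [h]
  simp only [coeff_add, coeff_sub, coeff_C_mul, finsetSum_coeff, coeff_mul_X_pow']

theorem coeff_mul_killer_of_lt (p : Polynomial ℝ) {k M : ℕ} (b c : ℝ) {j : ℕ} (hj : j < k) :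
    (p * killer k M b c).coeff j = p.coeff j := by
  rw [coeff_mul_killer, if_neg (by omega), Finset.sum_eq_zero]
  · ring
  · intro i hi
    rw [Finset.mem_Ioc] at hi
    exact if_neg (by omega)

theorem coeff_mul_killer_self {p : Polynomial ℝ} {k M : ℕ} {b c : ℝ} (hp : p.coeff 0 = 1)
    (hb : p.coeff k = b) : (p * killer k M b c).coeff k = 0 := by
  rw [coeff_mul_killer, if_pos le_rfl, Finset.sum_eq_zero, Nat.sub_self, hp, hb]
  · ring
  · intro i hi
    rw [Finset.mem_Ioc] at hi
    exact if_neg (by omega)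

theorem mul_killer_mem_unitCone {p : Polynomial ℝ} {k M : ℕ} {b c : ℝ} (hk : k ≠ 0)
    (hp : p ∈ UnitCone) (hb : p.coeff k = b) (hM : p.natDegree + k ≤ M)
    (hc : b * p.eval 1 ≤ c) : p * killer k M b c ∈ UnitCone := by
  have hb0 : 0 ≤ b := hb ▸ hp.1 k
  have hterm : ∀ i j, 0 ≤ (if i ≤ j then p.coeff (j - i) else 0) := fun i j => by
    split_ifs
    exacts [hp.1 _, le_rfl]
  have hc0 : 0 ≤ c :=
    (mul_nonneg hb0 ((hp.1 0).trans (coeff_le_eval_one hp.1 0))).trans hc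
  refine ⟨fun j => ?_, by rw [coeff_mul_killer_of_lt _ _ _ (by omega), hp.2]⟩
  rcases lt_trichotomy j k with hj | rfl | hj
  · rw [coeff_mul_killer_of_lt _ _ _ hj]
    exact hp.1 j
  · exact (coeff_mul_killer_self hp.2 hb).ge
  · rw [coeff_mul_killer, if_pos hj.le]
    have hsum := Finset.sum_nonneg (s := Finset.Ioc k M) fun i _ => hterm i j
    by_cases hjM : j ≤ M
    · have h1 := Finset.single_le_sum (s := Finset.Ioc k M) (fun i _ => hterm i j)
        (Finset.mem_Ioc.2 ⟨hj, hjM⟩)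
      rw [if_pos le_rfl, Nat.sub_self, hp.2] at h1
      have h2 := mul_le_mul_of_nonneg_left (coeff_le_eval_one hp.1 (j - k)) hb0
      have h3 := mul_le_mul_of_nonneg_left h1 hc0
      linarith [hp.1 j]
    · rw [coeff_eq_zero_of_natDegree_lt (show p.natDegree < j - k by omega)]
      linarith [hp.1 j, mul_nonneg hc0 hsum]

theorem eq_mul_of_additive_nonneg {h : ℝ → ℝ} (h0 : ∀ x, 0 ≤ x → 0 ≤ h x)
    (hadd : ∀ x y, 0 ≤ x → 0 ≤ y → h (x + y) = h x + h y) {a : ℝ} (ha : 0 ≤ a) :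
    h a = h 1 * a := by
  have hzero : h 0 = 0 := by
    have := hadd 0 0 le_rfl le_rfl
    rw [add_zero] at this
    linarith
  have hmono : ∀ x y, 0 ≤ x → x ≤ y → h x ≤ h y := fun x y hx hxy => by
    have := hadd x (y - x) hx (sub_nonneg.2 hxy)
    rw [add_sub_cancel] at this
    linarith [h0 (y - x) (sub_nonneg.2 hxy)]
  have hmul : ∀ (n : ℕ) (x : ℝ), 0 ≤ x → h (n * x) = n * h x := fun n x hx => by
    induction n with
    | zero => simp [hzero]
    | succ n ih =>
      rw [Nat.cast_succ, add_mul, one_mul, hadd _ _ (by positivity) hx, ih]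
      ring
  have hbound : ∀ n : ℕ, n * |h a - h 1 * a| ≤ h 1 := fun n => by
    have hna : 0 ≤ (n : ℝ) * a := by positivity
    have hfl := Nat.floor_le hna
    have hlt := (Nat.lt_floor_add_one ((n : ℝ) * a)).le
    have h1 := hmono _ _ (Nat.cast_nonneg _) hfl
    have h2 := hmono _ _ hna hlt
    have h3 := hmul ⌊(n : ℝ) * a⌋₊ 1 zero_le_one
    rw [mul_one] at h3
    rw [hadd _ _ (Nat.cast_nonneg _) zero_le_one, h3, hmul n a ha] at h2
    rw [h3, hmul n a ha] at h1
    have h4 := mul_le_mul_of_nonneg_right hfl (h0 1 zero_le_one)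
    have h5 := mul_le_mul_of_nonneg_right hlt (h0 1 zero_le_one)
    have h6 : |(n : ℝ) * (h a - h 1 * a)| = n * |h a - h 1 * a| := by
      rw [abs_mul, Nat.abs_cast]
    rw [← h6, abs_le]
    constructor <;> nlinarith
  by_contra hne
  have hpos : 0 < |h a - h 1 * a| := abs_pos.2 (sub_ne_zero.2 hne)
  obtain ⟨n, hn⟩ := exists_nat_gt (h 1 / |h a - h 1 * a|)
  rw [div_lt_iff₀ hpos] at hn
  linarith [hbound n]

theorem coeff_eq_zero_of_support {Ψ : Polynomial ℝ → Polynomial ℝ}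
    (hmap : ∀ p ∈ UnitCone, Ψ p ∈ UnitCone)
    (hsupp : ∀ p ∈ UnitCone, ∀ k : ℕ, 0 < (Ψ p).coeff k ↔ 0 < p.coeff k)
    {p : Polynomial ℝ} (hp : p ∈ UnitCone) {k : ℕ} (hk : p.coeff k = 0) :
    (Ψ p).coeff k = 0 :=
  le_antisymm (not_lt.1 fun h => ((hsupp p hp k).1 h).ne' hk) ((hmap p hp).1 k)

/-- The `k`-th coefficient of the image depends only on the `k`-th coefficient. -/
theorem coeff_map_eq_coeff_map_one_add_monomial {Ψ : Polynomial ℝ → Polynomial ℝ}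
    (hmap : ∀ p ∈ UnitCone, Ψ p ∈ UnitCone)
    (hsupp : ∀ p ∈ UnitCone, ∀ k : ℕ, 0 < (Ψ p).coeff k ↔ 0 < p.coeff k)
    (hmul : ∀ p ∈ UnitCone, ∀ q ∈ UnitCone, Ψ (p * q) = Ψ p * Ψ q)
    {p : Polynomial ℝ} (hp : p ∈ UnitCone) {k : ℕ} (hk : k ≠ 0) :
    (Ψ p).coeff k = (Ψ (1 + monomial k (p.coeff k))).coeff k := by
  set b := p.coeff k with hb
  set g : Polynomial ℝ := 1 + monomial k b with hg
  have hgap : ∀ j, 0 < j → j < k → g.coeff j = 0 := fun j h1 h2 => by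
    rw [hg, coeff_add, coeff_one, coeff_monomial, if_neg (by omega), if_neg (by omega), add_zero]
  have hgk : g.coeff k = b := by
    rw [hg, coeff_add, coeff_one, coeff_monomial, if_neg hk, if_pos rfl, zero_add]
  have hgU : g ∈ UnitCone := one_add_monomial_mem_unitCone hk (hp.1 k)
  set f := killer k (p.natDegree + g.natDegree + k) b (max (b * p.eval 1) (b * g.eval 1)) with hf
  have hpf : p * f ∈ UnitCone :=
    mul_killer_mem_unitCone hk hp hb.symm (by omega) (le_max_left _ _)
  have hgf : g * f ∈ UnitCone :=
    mul_killer_mem_unitCone hk hgU hgk (by omega) (le_max_right _ _)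
  have hpfk : (p * f).coeff k = 0 := coeff_mul_killer_self hp.2 hb.symm
  have hgfk : (g * f).coeff k = 0 := coeff_mul_killer_self hgU.2 hgk
  have hzero := @coeff_eq_zero_of_support Ψ hmap hsupp
  have key : Ψ (p * f) * Ψ g = Ψ p * Ψ (g * f) := by
    rw [← hmul _ hpf _ hgU, ← hmul _ hp _ hgf]
    congr 1
    ring
  have hcoeff := congrArg (fun q => coeff q k) key
  rw [coeff_mul_of_gap hk (hmap _ hpf).2 (hmap _ hgU).2
      fun j h1 h2 => hzero hgU (hgap j h1 h2),
    coeff_mul_of_gap hk (hmap _ hp).2 (hmap _ hgf).2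
      fun j h1 h2 => hzero hgf (by rw [hf, coeff_mul_killer_of_lt _ _ _ h2, hgap j h1 h2]),
    hzero hpf hpfk, hzero hgf hgfk] at hcoeff
  linarith

theorem exists_coeff_map_eq_pow_mul {Ψ : Polynomial ℝ → Polynomial ℝ}
    (hmap : ∀ p ∈ UnitCone, Ψ p ∈ UnitCone)
    (hsupp : ∀ p ∈ UnitCone, ∀ k : ℕ, 0 < (Ψ p).coeff k ↔ 0 < p.coeff k)
    (hmul : ∀ p ∈ UnitCone, ∀ q ∈ UnitCone, Ψ (p * q) = Ψ p * Ψ q) :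
    ∃ γ : ℝ, 0 < γ ∧ ∀ p ∈ UnitCone, ∀ k, (Ψ p).coeff k = γ ^ k * p.coeff k := by
  set φ : ℕ → ℝ → ℝ := fun k b => (Ψ (1 + monomial k b)).coeff k with hφ
  have hdep : ∀ p ∈ UnitCone, ∀ k, k ≠ 0 → (Ψ p).coeff k = φ k (p.coeff k) := fun p hp k hk =>
    coeff_map_eq_coeff_map_one_add_monomial hmap hsupp hmul hp hk
  have hmem := @one_add_monomial_mem_unitCone
  have hself : ∀ (k : ℕ) (b : ℝ), k ≠ 0 → (1 + monomial k b : Polynomial ℝ).coeff k = b :=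
    fun k b hk => by
      rw [coeff_add, coeff_one, coeff_monomial, if_neg hk, if_pos rfl, zero_add]
  have hlin : ∀ k, k ≠ 0 → ∀ a, 0 ≤ a → φ k a = φ k 1 * a := fun k hk a ha => by
    refine eq_mul_of_additive_nonneg (fun x hx => (hmap _ (hmem hk hx)).1 k)
      (fun x y hx hy => ?_) ha
    have hgap : ∀ j, 0 < j → j < k → (1 + monomial k y : Polynomial ℝ).coeff j = 0 :=
      fun j h1 h2 => by
        rw [coeff_add, coeff_one, coeff_monomial, if_neg (by omega), if_neg (by omega), add_zero]
    have h := hdep _ (mul_mem_unitCone (hmem hk hx) (hmem hk hy)) k hk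
    rw [hmul _ (hmem hk hx) _ (hmem hk hy),
      coeff_mul_of_gap hk (hmap _ (hmem hk hx)).2 (hmap _ (hmem hk hy)).2
        (fun j h1 h2 => coeff_eq_zero_of_support hmap hsupp (hmem hk hy) (hgap j h1 h2)),
      coeff_mul_of_gap hk (hmem hk hx).2 (hmem hk hy).2 hgap, hself k x hk, hself k y hk] at h
    exact h.symm
  have himage : ∀ k, k ≠ 0 → Ψ (1 + monomial k 1) = 1 + monomial k (φ k 1) := fun k hk => by
    ext j
    rcases eq_or_ne j k with rfl | hjk
    · rw [hself _ _ hk]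
    rcases eq_or_ne j 0 with rfl | hj
    · rw [(hmap _ (hmem hk zero_le_one)).2, coeff_add, coeff_one, coeff_monomial, if_pos rfl,
        if_neg hk, add_zero]
    have h : ∀ b : ℝ, (1 + monomial k b : Polynomial ℝ).coeff j = 0 := fun b => by
      rw [coeff_add, coeff_one, coeff_monomial, if_neg hj, if_neg hjk.symm, add_zero]
    rw [h, coeff_eq_zero_of_support hmap hsupp (hmem hk zero_le_one) (h 1)]
  have hpow : ∀ k, φ (k + 1) 1 = φ 1 1 ^ (k + 1) := fun k => by
    induction k with
    | zero => rw [zero_add, pow_one]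
    | succ k ih =>
      have hk : k + 1 ≠ 0 := k.succ_ne_zero
      have hcoeff : ∀ a b : ℝ, ((1 + monomial (k + 1) a) * (1 + monomial 1 b) :
          Polynomial ℝ).coeff (k + 1 + 1) = a * b := fun a b => by
        rw [add_mul, one_mul, mul_add, mul_one, monomial_mul_monomial]
        simp only [coeff_add, coeff_one, coeff_monomial]
        simp
      have h := hdep _ (mul_mem_unitCone (hmem hk zero_le_one) (hmem one_ne_zero zero_le_one))
        (k + 1 + 1) (by omega)
      rw [hmul _ (hmem hk zero_le_one) _ (hmem one_ne_zero zero_le_one), himage _ hk,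
        himage _ one_ne_zero, hcoeff, hcoeff, mul_one] at h
      rw [← h, ih, pow_succ _ (k + 1)]
  refine ⟨φ 1 1, ?_, fun p hp k => ?_⟩
  · refine (hsupp _ (hmem one_ne_zero zero_le_one) 1).2 ?_
    rw [hself _ _ one_ne_zero]
    exact one_pos
  · rcases k with _ | k
    · rw [(hmap p hp).2, hp.2, pow_zero, mul_one]
    · rw [hdep p hp _ k.succ_ne_zero, hlin _ k.succ_ne_zero _ (hp.1 _), hpow]

theorem eval_one_pos_of_mem_unitCone {p : Polynomial ℝ} (hp : p ∈ UnitCone) : 0 < p.eval 1 :=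
  (hp.2 ▸ one_pos : 0 < p.coeff 0).trans_le (coeff_le_eval_one hp.1 0)

theorem normalize_mem_Pset {p : Polynomial ℝ} (hp : p ∈ UnitCone) :
    C (p.eval 1)⁻¹ * p ∈ Pset := by
  have h := eval_one_pos_of_mem_unitCone hp
  refine ⟨fun k => ?_, by rw [eval_mul, eval_C, inv_mul_cancel₀ h.ne']⟩
  rw [coeff_C_mul]
  exact mul_nonneg (inv_nonneg.2 h.le) (hp.1 k)

theorem normalize_mem_unitCone {p : Polynomial ℝ} (hp : ∀ k, 0 ≤ p.coeff k)
    (h0 : 0 < p.coeff 0) : C (p.coeff 0)⁻¹ * p ∈ UnitCone := by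
  refine ⟨fun k => ?_, by rw [coeff_C_mul, inv_mul_cancel₀ h0.ne']⟩
  rw [coeff_C_mul]
  exact mul_nonneg (inv_nonneg.2 h0.le) (hp k)

theorem exists_coeff_map_eq_of_coeff_zero_pos {Φ : Polynomial ℝ → Polynomial ℝ}
    (hmap : ∀ p ∈ Pset, Φ p ∈ Pset)
    (hsupp : ∀ p ∈ Pset, ∀ k : ℕ, 0 < (Φ p).coeff k ↔ 0 < p.coeff k)
    (hmul : ∀ p ∈ Pset, ∀ q ∈ Pset, Φ (p * q) = Φ p * Φ q) :
    ∃ γ : ℝ, 0 < γ ∧ ∀ p ∈ Pset, 0 < p.coeff 0 →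
      ∃ c, ∀ k, (Φ p).coeff k = c * (γ ^ k * p.coeff k) := by
  set N : Polynomial ℝ → Polynomial ℝ := fun p => C (p.eval 1)⁻¹ * p with hN
  have hNmul : ∀ p q, N (p * q) = N p * N q := fun p q => by
    simp only [hN, eval_mul, mul_inv, C_mul]
    ring
  have hpos : ∀ p ∈ UnitCone, ∀ k, 0 < (Φ (N p)).coeff k ↔ 0 < p.coeff k := fun p hp k => by
    rw [hsupp _ (normalize_mem_Pset hp), coeff_C_mul,
      mul_pos_iff_of_pos_left (inv_pos.2 (eval_one_pos_of_mem_unitCone hp))]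
  have hpos0 : ∀ p ∈ UnitCone, 0 < (Φ (N p)).coeff 0 := fun p hp =>
    (hpos p hp 0).2 (hp.2 ▸ one_pos)
  obtain ⟨γ, hγ, h⟩ := exists_coeff_map_eq_pow_mul
    (Ψ := fun p => C ((Φ (N p)).coeff 0)⁻¹ * Φ (N p))
    (fun p hp => normalize_mem_unitCone (hmap _ (normalize_mem_Pset hp)).1 (hpos0 p hp))
    (fun p hp k => by
      rw [coeff_C_mul, mul_pos_iff_of_pos_left (inv_pos.2 (hpos0 p hp)), hpos p hp])
    (fun p hp q hq => by
      rw [hNmul, hmul _ (normalize_mem_Pset hp) _ (normalize_mem_Pset hq), mul_coeff_zero,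
        mul_inv, C_mul]
      ring)
  refine ⟨γ, hγ, fun p hp hp0 => ?_⟩
  have hU := normalize_mem_unitCone hp.1 hp0
  have hNp : N (C (p.coeff 0)⁻¹ * p) = p := by
    simp only [hN, eval_mul, eval_C, hp.2, mul_one, inv_inv]
    rw [← mul_assoc, ← C_mul, mul_inv_cancel₀ hp0.ne', C_1, one_mul]
  have h0 := hpos0 _ hU
  rw [hNp] at h0
  refine ⟨(Φ p).coeff 0 * (p.coeff 0)⁻¹, fun k => ?_⟩
  have hk := h _ hU k
  simp only [hNp, coeff_C_mul] at hk
  rw [inv_mul_eq_iff_eq_mul₀ h0.ne'] at hk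
  rw [hk]
  ring

theorem X_pow_mem_Pset (m : ℕ) : (X ^ m : Polynomial ℝ) ∈ Pset := by
  refine ⟨fun k => ?_, by simp⟩
  rw [coeff_X_pow]
  split_ifs <;> norm_num

theorem map_X_pow {Φ : Polynomial ℝ → Polynomial ℝ} (hmap : ∀ p ∈ Pset, Φ p ∈ Pset)
    (hsupp : ∀ p ∈ Pset, ∀ k : ℕ, 0 < (Φ p).coeff k ↔ 0 < p.coeff k) (m : ℕ) :
    Φ (X ^ m) = X ^ m := by
  have hX := X_pow_mem_Pset m
  have hmon : Φ (X ^ m) = C ((Φ (X ^ m)).coeff m) * X ^ m := by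
    ext j
    rw [coeff_C_mul_X_pow]
    split_ifs with hj
    · rw [hj]
    · refine le_antisymm (not_lt.1 fun h => ?_) ((hmap _ hX).1 j)
      rw [hsupp _ hX, coeff_X_pow, if_neg hj] at h
      exact h.false
  have h1 := (hmap _ hX).2
  rw [hmon, eval_mul, eval_C, eval_pow, eval_X, one_pow, mul_one] at h1
  rw [hmon, h1, C_1, one_mul]

theorem eq_C_inv_mul_comp {p q : Polynomial ℝ} {γ c : ℝ} (hq : q.eval 1 = 1)
    (h : ∀ k, q.coeff k = c * (γ ^ k * p.coeff k)) :
    q = C (p.eval γ)⁻¹ * p.comp (C γ * X) := by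
  have hqp : q = C c * p.comp (C γ * X) := by
    ext k
    rw [h, coeff_C_mul, comp_C_mul_X_coeff, mul_comm (p.coeff k)]
  have h1 := hq
  rw [hqp, eval_mul, eval_C, eval_comp, eval_mul, eval_C, eval_X, mul_one] at h1
  rw [hqp, ← eq_inv_of_mul_eq_one_left h1]

theorem stmt_0 (Φ : Polynomial ℝ → Polynomial ℝ)
    (hmap : ∀ p ∈ Pset, Φ p ∈ Pset)
    (hsupp : ∀ p ∈ Pset, ∀ k : ℕ, 0 < (Φ p).coeff k ↔ 0 < p.coeff k)
    (hmul : ∀ p ∈ Pset, ∀ q ∈ Pset, Φ (p * q) = Φ p * Φ q) :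
    ∃ γ : ℝ, 0 < γ ∧ ∀ p ∈ Pset,
      Φ p = C (p.eval γ)⁻¹ * p.comp (C γ * X) := by
  obtain ⟨γ, hγ, h⟩ := exists_coeff_map_eq_of_coeff_zero_pos hmap hsupp hmul
  refine ⟨γ, hγ, fun p hp => ?_⟩
  have hp0 : p ≠ 0 := by
    rintro rfl
    simpa using hp.2
  obtain ⟨q, hpq, hXq⟩ := exists_eq_pow_rootMultiplicity_mul_and_not_dvd p hp0 0
  set m := p.rootMultiplicity 0
  rw [C_0, sub_zero] at hpq hXq
  have hcoeff : ∀ k, q.coeff k = p.coeff (k + m) := fun k => by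
    rw [hpq, coeff_X_pow_mul]
  have hq : q ∈ Pset := by
    refine ⟨fun k => hcoeff k ▸ hp.1 _, ?_⟩
    have := hp.2
    rwa [hpq, eval_mul, eval_pow, eval_X, one_pow, one_mul] at this
  have hq0 : 0 < q.coeff 0 := (hq.1 0).lt_of_ne' fun h0 => hXq (X_dvd_iff.2 h0)
  obtain ⟨c, hc⟩ := h q hq hq0
  refine eq_C_inv_mul_comp (c := c * (γ ^ m)⁻¹) (hmap p hp).2 fun k => ?_
  have hΦ : Φ p = X ^ m * Φ q := by
    rw [hpq, hmul _ (X_pow_mem_Pset m) _ hq, map_X_pow hmap hsupp]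
  rw [hΦ, hpq, coeff_X_pow_mul', coeff_X_pow_mul']
  split_ifs with hk
  · obtain ⟨j, rfl⟩ := Nat.exists_eq_add_of_le' hk
    rw [Nat.add_sub_cancel, hc, pow_add]
    field_simp
  · simp
end

section
/- Let Φ : 𝒫(ℤ) → 𝒫(ℤ) be a support-preserving endomorphism. Then there exists a real constant β such that for every μ ∈ 𝒫(ℤ) and every z ∈ ℤ, Φ[μ](z) = μ(z)·exp(−βz) / (Σ_{y ∈ ℤ} μ(y)·exp(−βy)). -/
/-- `PZ` is the set of finitely supported probability measures on `ℤ`,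
represented as functions `ℤ → ℝ`. -/
def PZ : Set (ℤ → ℝ) :=
  {μ | (Function.support μ).Finite ∧ (∀ z, 0 ≤ μ z) ∧ ∑ᶠ z, μ z = 1}

/-- Convolution of two functions `ℤ → ℝ`. -/
noncomputable def convZ (μ ν : ℤ → ℝ) : ℤ → ℝ := fun z => ∑ᶠ t, μ t * ν (z - t)

open Polynomial

/-- Nonzero real polynomials with nonnegative coefficients. -/
def NonnegCoeff (p : ℝ[X]) : Prop := p ≠ 0 ∧ ∀ n, 0 ≤ p.coeff n

namespace NonnegCoeff

variable {p q : ℝ[X]}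

lemma leadingCoeff_pos (hp : NonnegCoeff p) : 0 < p.leadingCoeff :=
  lt_of_le_of_ne (hp.2 _) (Ne.symm (leadingCoeff_ne_zero.mpr hp.1))

lemma mul (hp : NonnegCoeff p) (hq : NonnegCoeff q) : NonnegCoeff (p * q) :=
  ⟨mul_ne_zero hp.1 hq.1, fun n => by
    rw [coeff_mul]
    exact Finset.sum_nonneg fun i _ => mul_nonneg (hp.2 _) (hq.2 _)⟩

lemma add (hp : NonnegCoeff p) (hq : NonnegCoeff q) : NonnegCoeff (p + q) := by
  refine ⟨fun h => ?_, fun n => by rw [coeff_add]; exact add_nonneg (hp.2 _) (hq.2 _)⟩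
  have h1 := congrArg (fun r => coeff r p.natDegree) h
  simp only [coeff_add, coeff_zero, coeff_natDegree] at h1
  linarith [hp.leadingCoeff_pos, hq.2 p.natDegree]

lemma const {a : ℝ} (ha : 0 < a) : NonnegCoeff (C a) :=
  ⟨C_ne_zero.mpr ha.ne', fun n => by rw [coeff_C]; split_ifs <;> simp [ha.le]⟩

lemma X_pow (k : ℕ) : NonnegCoeff (X ^ k : ℝ[X]) :=
  ⟨pow_ne_zero _ X_ne_zero, fun n => by rw [coeff_X_pow]; split_ifs <;> simp⟩

lemma var : NonnegCoeff (X : ℝ[X]) := by simpa using X_pow 1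

lemma one : NonnegCoeff (1 : ℝ[X]) := by simpa using X_pow 0

lemma linear {a : ℝ} (ha : 0 < a) : NonnegCoeff (X + C a) := var.add (const ha)

lemma quadratic {a b : ℝ} (ha : 0 < a) (hb : 0 < b) :
    NonnegCoeff (X ^ 2 + C a * X + C b) :=
  ((X_pow 2).add ((const ha).mul var)).add (const hb)

lemma eval_pos (hp : NonnegCoeff p) {x : ℝ} (hx : 0 < x) : 0 < p.eval x := by
  rw [eval_eq_sum_range]
  exact Finset.sum_pos' (fun i _ => mul_nonneg (hp.2 _) (pow_nonneg hx.le _))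
    ⟨p.natDegree, by simp, mul_pos hp.leadingCoeff_pos (pow_pos hx _)⟩

lemma expand (hp : NonnegCoeff p) {k : ℕ} (hk : 0 < k) : NonnegCoeff (expand ℝ k p) :=
  ⟨(expand_ne_zero hk).mpr hp.1, fun n => by
    rw [coeff_expand hk]; split_ifs
    · exact hp.2 _
    · exact le_rfl⟩

end NonnegCoeff

/-- The real polynomial of degree at most four with the given coefficients. -/
noncomputable def quartic (a b c d e : ℝ) : ℝ[X] :=
  C a * X ^ 4 + C b * X ^ 3 + C c * X ^ 2 + C d * X + C e

section quartic

variable (a b c d e : ℝ)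

@[simp] lemma coeff_quartic_zero : (quartic a b c d e).coeff 0 = e := by simp [quartic]

@[simp] lemma coeff_quartic_one : (quartic a b c d e).coeff 1 = d := by
  simp [quartic, coeff_X_pow, coeff_C]

@[simp] lemma coeff_quartic_two : (quartic a b c d e).coeff 2 = c := by
  simp [quartic, coeff_X_pow]

@[simp] lemma coeff_quartic_three : (quartic a b c d e).coeff 3 = b := by
  simp [quartic, coeff_X_pow]

@[simp] lemma coeff_quartic_four : (quartic a b c d e).coeff 4 = a := by
  simp [quartic, coeff_X_pow]

lemma natDegree_quartic_le : (quartic a b c d e).natDegree ≤ 4 := by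
  unfold quartic; compute_degree

lemma eq_quartic {p : ℝ[X]} (hp : p.natDegree ≤ 4) :
    p = quartic (p.coeff 4) (p.coeff 3) (p.coeff 2) (p.coeff 1) (p.coeff 0) := by
  rw [quartic]
  conv_lhs => rw [as_sum_range_C_mul_X_pow' p (show p.natDegree < 5 by lia)]
  simp only [Finset.sum_range_succ, Finset.sum_range_zero]
  ring

lemma natDegree_quartic_zero_one : (quartic 0 1 c d e).natDegree = 3 := by
  simp only [quartic, map_zero, zero_mul, zero_add]; compute_degree!

lemma natDegree_quartic_zero_zero_one : (quartic 0 0 1 d e).natDegree = 2 := by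
  simp only [quartic, map_zero, zero_mul, zero_add]; compute_degree!

variable {a b c d e}

lemma quartic_nonnegCoeff (ha : 0 ≤ a) (hb : 0 ≤ b) (hc : 0 ≤ c) (hd : 0 ≤ d) (he : 0 < e) :
    NonnegCoeff (quartic a b c d e) := by
  refine ⟨fun h => ?_, fun n => ?_⟩
  · have := congrArg (coeff · 0) h
    simp at this
    exact he.ne' this
  · by_cases h : n ≤ 4
    · interval_cases n <;> simp [*, he.le]
    · rw [coeff_eq_zero_of_natDegree_lt]
      exact (natDegree_quartic_le a b c d e).trans_lt (by lia)

end quartic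

/-- Multiplicative maps on polynomials with nonnegative coefficients which preserve the support
and the leading coefficient. -/
structure SuppEndo (Ψ : ℝ[X] → ℝ[X]) : Prop where
  map_mul : ∀ p q, NonnegCoeff p → NonnegCoeff q → Ψ (p * q) = Ψ p * Ψ q
  nonneg : ∀ p, NonnegCoeff p → ∀ n, 0 ≤ (Ψ p).coeff n
  coeff_eq_zero_iff : ∀ p, NonnegCoeff p → ∀ n, (Ψ p).coeff n = 0 ↔ p.coeff n = 0
  leadingCoeff : ∀ p, NonnegCoeff p → (Ψ p).leadingCoeff = p.leadingCoeff

/-- `ExtendsTo Ψ q r` says that the extension of `Ψ` to quotients sends `q` to `r`. -/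
def ExtendsTo (Ψ : ℝ[X] → ℝ[X]) (q r : ℝ[X]) : Prop :=
  ∃ s, NonnegCoeff s ∧ NonnegCoeff (s * q) ∧ Ψ (s * q) = Ψ s * r

namespace SuppEndo

variable {Ψ : ℝ[X] → ℝ[X]} (S : SuppEndo Ψ)

include S

lemma support_eq {p : ℝ[X]} (hp : NonnegCoeff p) : (Ψ p).support = p.support := by
  ext n; simp [S.coeff_eq_zero_iff p hp n]

lemma natDegree_eq {p : ℝ[X]} (hp : NonnegCoeff p) : (Ψ p).natDegree = p.natDegree := by
  rw [natDegree_eq_support_max' hp.1, natDegree_eq_support_max' (p := Ψ p)]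
  · simp only [S.support_eq hp]
  · rw [← support_nonempty, S.support_eq hp, support_nonempty]; exact hp.1

lemma map_nonnegCoeff {p : ℝ[X]} (hp : NonnegCoeff p) : NonnegCoeff (Ψ p) :=
  ⟨by rw [← support_nonempty, S.support_eq hp, support_nonempty]; exact hp.1, S.nonneg p hp⟩

lemma coeff_pos {p : ℝ[X]} (hp : NonnegCoeff p) {n : ℕ} (h : p.coeff n ≠ 0) :
    0 < (Ψ p).coeff n :=
  lt_of_le_of_ne (S.nonneg p hp n) fun h' => h ((S.coeff_eq_zero_iff p hp n).mp h'.symm)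

lemma coeff_zero {p : ℝ[X]} (hp : NonnegCoeff p) {n : ℕ} (h : p.coeff n = 0) :
    (Ψ p).coeff n = 0 := (S.coeff_eq_zero_iff p hp n).mpr h

lemma map_eq_sum {p : ℝ[X]} (hp : NonnegCoeff p) (hm : p.Monic) :
    Ψ p = X ^ p.natDegree + ∑ i ∈ Finset.range p.natDegree, C ((Ψ p).coeff i) * X ^ i := by
  have h : (Ψ p).Monic := by rw [Monic, S.leadingCoeff p hp]; exact hm
  have h1 := h.as_sum
  rwa [S.natDegree_eq hp] at h1

lemma map_C {a : ℝ} (ha : 0 < a) : Ψ (C a) = C a := by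
  have h := NonnegCoeff.const ha
  have h1 := S.natDegree_eq h
  rw [natDegree_C] at h1
  rw [eq_C_of_natDegree_eq_zero h1]
  have h2 := S.leadingCoeff _ h
  rw [Polynomial.leadingCoeff, h1, leadingCoeff_C] at h2
  rw [h2]

lemma map_one : Ψ 1 = 1 := by simpa using S.map_C one_pos

lemma map_X : Ψ X = X := by
  have h := S.map_eq_sum NonnegCoeff.var monic_X
  simpa [Finset.sum_range_succ, S.coeff_zero NonnegCoeff.var (n := 0) (by simp)] using h

lemma map_linear {a : ℝ} (ha : 0 < a) : ∃ a', 0 < a' ∧ Ψ (X + C a) = X + C a' := by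
  have h := NonnegCoeff.linear ha
  have h1 := S.map_eq_sum h (monic_X_add_C a)
  rw [natDegree_X_add_C] at h1
  exact ⟨(Ψ (X + C a)).coeff 0, S.coeff_pos h (by simp [ha.ne']), by simpa using h1⟩

lemma apply_mul_of_extendsTo {q r t : ℝ[X]} (h : ExtendsTo Ψ q r) (ht : NonnegCoeff t)
    (htq : NonnegCoeff (t * q)) : Ψ (t * q) = Ψ t * r := by
  obtain ⟨s, hs, hsq, e⟩ := h
  have h1 := S.map_mul t (s * q) ht hsq
  have h2 := S.map_mul s (t * q) hs htq
  rw [show s * (t * q) = t * (s * q) by ring, h1, e] at h2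
  have := (S.map_nonnegCoeff hs).1
  apply mul_left_cancel₀ this
  rw [← h2]; ring

lemma apply_of_extendsTo {q r : ℝ[X]} (h : ExtendsTo Ψ q r) (hq : NonnegCoeff q) :
    Ψ q = r := by
  have h1 := S.apply_mul_of_extendsTo h NonnegCoeff.one (by simpa using hq)
  simpa [S.map_one] using h1

lemma extendsTo_self {q : ℝ[X]} (hq : NonnegCoeff q) : ExtendsTo Ψ q (Ψ q) :=
  ⟨1, NonnegCoeff.one, by simpa using hq, by simp [S.map_one]⟩

lemma extendsTo_mul {q r q' r' : ℝ[X]} (h : ExtendsTo Ψ q r) (h' : ExtendsTo Ψ q' r') :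
    ExtendsTo Ψ (q * q') (r * r') := by
  obtain ⟨s, hs, hsq, e⟩ := h
  obtain ⟨s', hs', hsq', e'⟩ := h'
  refine ⟨s * s', hs.mul hs', ?_, ?_⟩
  · rw [mul_mul_mul_comm]; exact hsq.mul hsq'
  · rw [mul_mul_mul_comm, S.map_mul _ _ hsq hsq', S.map_mul _ _ hs hs', e, e']; ring

lemma extendsTo_of_mul {q p r : ℝ[X]} (hp : NonnegCoeff p)
    (h : ExtendsTo Ψ (q * p) (r * Ψ p)) : ExtendsTo Ψ q r := by
  obtain ⟨s, hs, hsq, e⟩ := h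
  refine ⟨s * p, hs.mul hp, ?_, ?_⟩
  · rwa [mul_assoc, mul_comm p]
  · rw [mul_assoc, mul_comm p, e, S.map_mul _ _ hs hp]; ring

lemma coeff_natDegree_eq {p : ℝ[X]} (hp : NonnegCoeff p) {n : ℕ} (hn : p.natDegree = n) :
    (Ψ p).coeff n = p.coeff n := by
  have h := S.leadingCoeff p hp
  rwa [Polynomial.leadingCoeff, Polynomial.leadingCoeff, S.natDegree_eq hp, hn] at h

lemma map_eq_quartic {p : ℝ[X]} (hp : NonnegCoeff p) (h : p.natDegree ≤ 4) :
    Ψ p = quartic ((Ψ p).coeff 4) ((Ψ p).coeff 3) ((Ψ p).coeff 2) ((Ψ p).coeff 1)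
      ((Ψ p).coeff 0) :=
  eq_quartic (by rwa [S.natDegree_eq hp])

lemma extendsTo_quadratic {b d β δ : ℝ} (hb : 0 < b) (hbd : b < d)
    (h1 : Ψ (X + C b) = X + C β) (h2 : Ψ (X + C d) = X + C δ) :
    β < δ ∧ ExtendsTo Ψ (X ^ 2 - C b * X + C (b * d)) (X ^ 2 - C β * X + C (β * δ)) := by
  have hd : 0 < d := hb.trans hbd
  have hdb : 0 < d - b := sub_pos.mpr hbd
  have e1 : (X + C b) * (X ^ 2 - C b * X + C (b * d)) =
      quartic 0 1 0 (b * (d - b)) (b * b * d) := by simp [quartic]; ring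
  have e2 : (X + C d) * (X ^ 2 - C b * X + C (b * d)) =
      quartic 0 1 (d - b) 0 (b * d * d) := by simp [quartic]; ring
  have n1 : NonnegCoeff (quartic 0 1 0 (b * (d - b)) (b * b * d)) :=
    quartic_nonnegCoeff le_rfl zero_le_one le_rfl (by positivity) (by positivity)
  have n2 : NonnegCoeff (quartic 0 1 (d - b) 0 (b * d * d)) :=
    quartic_nonnegCoeff le_rfl zero_le_one hdb.le le_rfl (by positivity)
  have s1 := S.map_eq_quartic n1 (natDegree_quartic_le _ _ _ _ _)
  have s2 := S.map_eq_quartic n2 (natDegree_quartic_le _ _ _ _ _)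
  rw [S.coeff_zero n1 (n := 4) (by simp), S.coeff_zero n1 (n := 2) (by simp),
    S.coeff_natDegree_eq n1 (natDegree_quartic_zero_one _ _ _), coeff_quartic_three] at s1
  rw [S.coeff_zero n2 (n := 4) (by simp), S.coeff_zero n2 (n := 1) (by simp),
    S.coeff_natDegree_eq n2 (natDegree_quartic_zero_one _ _ _), coeff_quartic_three] at s2
  have p2 := S.coeff_pos n2 (n := 2) (by simpa using hdb.ne')
  have key : (X + C δ) * Ψ (quartic 0 1 0 (b * (d - b)) (b * b * d)) =
      (X + C β) * Ψ (quartic 0 1 (d - b) 0 (b * d * d)) := by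
    rw [← h1, ← h2, ← S.map_mul _ _ (NonnegCoeff.linear hd) n1,
      ← S.map_mul _ _ (NonnegCoeff.linear hb) n2, ← e1, ← e2]
    congr 1; ring
  generalize (Ψ (quartic 0 1 0 (b * (d - b)) (b * b * d))).coeff 1 = s at s1
  generalize (Ψ (quartic 0 1 0 (b * (d - b)) (b * b * d))).coeff 0 = t at s1
  generalize (Ψ (quartic 0 1 (d - b) 0 (b * d * d))).coeff 2 = u at s2 p2
  generalize (Ψ (quartic 0 1 (d - b) 0 (b * d * d))).coeff 0 = v at s2
  have key' : quartic 1 δ s (t + δ * s) (δ * t) = quartic 1 (u + β) (β * u) v (β * v) := by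
    rw [s1, s2] at key
    simp only [quartic, map_add, C_mul, _root_.map_one, map_zero] at key ⊢
    linear_combination key
  have c3 := congrArg (coeff · 3) key'
  have c2 := congrArg (coeff · 2) key'
  have c1 := congrArg (coeff · 1) key'
  have c0 := congrArg (coeff · 0) key'
  simp only [coeff_quartic_zero, coeff_quartic_one, coeff_quartic_two,
    coeff_quartic_three] at c0 c1 c2 c3
  have hs : s = β * (δ - β) := by rw [c2, c3]; ring
  have ht : t = δ * β ^ 2 := by
    have : (δ - β) * t = (δ - β) * (δ * β ^ 2) := by
      rw [← c1, hs] at c0; linear_combination c0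
    exact mul_left_cancel₀ (by rw [c3]; simpa using p2.ne') this
  refine ⟨by linarith, X + C b, NonnegCoeff.linear hb, by rw [e1]; exact n1, ?_⟩
  rw [e1, s1, h1, hs, ht]
  simp [quartic]; ring

lemma add_of_map_linear {u v u' v' w : ℝ} (hu : 0 < u) (hv : 0 < v)
    (h1 : Ψ (X + C u) = X + C u') (h2 : Ψ (X + C v) = X + C v')
    (h3 : Ψ (X + C (u + v)) = X + C w) : w = u' + v' := by
  have hb : 0 < u + v := add_pos hu hv
  obtain ⟨δ, -, hδ⟩ := S.map_linear (show 0 < 2 * (u + v) by linarith)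
  obtain ⟨-, hE⟩ := S.extendsTo_quadratic hb (show u + v < 2 * (u + v) by linarith) h3 hδ
  have e : (X + C u) * (X + C v) * (X ^ 2 - C (u + v) * X + C ((u + v) * (2 * (u + v)))) =
      quartic 1 0 (u * v + (u + v) ^ 2) ((u + v) * (2 * (u + v) ^ 2 - u * v))
        (2 * u * v * (u + v) ^ 2) := by
    simp only [quartic, map_add, C_mul, map_sub, C_pow, map_ofNat, _root_.map_one, map_zero]
    ring
  have n : NonnegCoeff ((X + C u) * (X + C v) *
      (X ^ 2 - C (u + v) * X + C ((u + v) * (2 * (u + v))))) := by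
    rw [e]
    exact quartic_nonnegCoeff zero_le_one le_rfl (by positivity)
      (mul_nonneg hb.le (by nlinarith [mul_pos hu hv])) (by positivity)
  have h := S.apply_mul_of_extendsTo hE ((NonnegCoeff.linear hu).mul (NonnegCoeff.linear hv)) n
  have z := S.coeff_zero n (n := 3) (by rw [e]; simp)
  rw [h, S.map_mul _ _ (NonnegCoeff.linear hu) (NonnegCoeff.linear hv), h1, h2,
    show (X + C u') * (X + C v') * (X ^ 2 - C w * X + C (w * δ)) =
      quartic 1 (u' + v' - w) (u' * v' - (u' + v') * w + w * δ)
        ((u' + v') * (w * δ) - u' * v' * w) (u' * v' * (w * δ)) by simp [quartic]; ring,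
    coeff_quartic_three] at z
  linarith

/-- On linear factors, `Ψ` scales the root by a constant. -/
lemma exists_map_linear : ∃ κ, 0 < κ ∧ ∀ a, 0 < a → Ψ (X + C a) = X + C (a * κ) := by
  choose! φ hφ0 hφ using fun a (ha : 0 < a) => S.map_linear ha
  have hadd : ∀ a b, 0 < a → 0 < b → φ (a + b) = φ a + φ b := fun a b ha hb =>
    S.add_of_map_linear ha hb (hφ a ha) (hφ b hb) (hφ _ (add_pos ha hb))
  have hmono : ∀ a b, 0 < a → a < b → φ a < φ b := fun a b ha hab =>
    (S.extendsTo_quadratic ha hab (hφ a ha) (hφ b (ha.trans hab))).1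
  have hnat : ∀ n : ℕ, ∀ a, 0 < a → φ ((n + 1 : ℕ) * a) = (n + 1 : ℕ) * φ a := by
    intro n a ha
    induction n with
    | zero => simp
    | succ n ih =>
      rw [show ((n + 1 + 1 : ℕ) : ℝ) * a = ((n + 1 : ℕ) : ℝ) * a + a by push_cast; ring,
        hadd _ _ (by positivity) ha, ih]
      push_cast; ring
  have hrat : ∀ q : ℚ, 0 < q → φ q = q * φ 1 := by
    intro q hq
    have hn : 0 < q.num.toNat := by have := Rat.num_pos.mpr hq; lia
    obtain ⟨m, hm⟩ := Nat.exists_eq_add_of_lt hn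
    obtain ⟨k, hk⟩ := Nat.exists_eq_add_of_lt q.den_pos
    rw [zero_add] at hm hk
    have hqr : (0 : ℝ) < q := by exact_mod_cast hq
    have hqm : (q : ℝ) * q.den = q.num.toNat := by
      have h1 : q * q.den = (q.num.toNat : ℚ) := by
        rw [Rat.mul_den_eq_num, ← Int.cast_natCast,
          Int.toNat_of_nonneg (Rat.num_nonneg.mpr hq.le)]
      exact_mod_cast h1
    have h1 := hnat k q hqr
    have h2 := hnat m 1 one_pos
    rw [← hk, mul_comm, hqm] at h1
    rw [← hm, mul_one] at h2
    have hd : (q.den : ℝ) ≠ 0 := by exact_mod_cast q.den_nz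
    apply mul_left_cancel₀ hd
    rw [← h1, h2, ← hqm]; ring
  have h1 := hφ0 1 one_pos
  refine ⟨φ 1, h1, fun a ha => ?_⟩
  rw [hφ a ha]
  congr 2
  apply le_antisymm
  · by_contra! h
    obtain ⟨q, hq1, hq2⟩ := exists_rat_btwn ((lt_div_iff₀ h1).mpr h)
    have hq : (0 : ℝ) < q := ha.trans hq1
    have := hmono a q ha hq1
    rw [hrat q (by exact_mod_cast hq)] at this
    rw [lt_div_iff₀ h1] at hq2
    linarith
  · by_contra! h
    obtain ⟨q, hq1, hq2⟩ := exists_rat_btwn ((div_lt_iff₀ h1).mpr h)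
    have hq : (0 : ℝ) < q := (div_pos (hφ0 a ha) h1).trans hq1
    have := hmono q a hq hq2
    rw [hrat q (by exact_mod_cast hq)] at this
    rw [div_lt_iff₀ h1] at hq1
    linarith

end SuppEndo

namespace SuppEndo

variable {Ψ : ℝ[X] → ℝ[X]}

lemma scaleRoots (S : SuppEndo Ψ) {s : ℝ} (hs : 0 < s) :
    SuppEndo fun p => (Ψ p).scaleRoots s where
  map_mul p q hp hq := by
    simp only [S.map_mul p q hp hq, mul_scaleRoots_of_noZeroDivisors]
  nonneg p hp n := by
    rw [coeff_scaleRoots]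
    exact mul_nonneg (S.nonneg p hp n) (by positivity)
  coeff_eq_zero_iff p hp n := by
    rw [coeff_scaleRoots, ← S.coeff_eq_zero_iff p hp n]
    simp [(pow_pos hs _).ne']
  leadingCoeff p hp := by rw [leadingCoeff_scaleRoots, S.leadingCoeff p hp]

/-- The map induced by `Ψ` on even polynomials. -/
noncomputable def evenPart (Ψ : ℝ[X] → ℝ[X]) (p : ℝ[X]) : ℝ[X] :=
  contract 2 (Ψ (expand ℝ 2 p))

lemma expand_evenPart (S : SuppEndo Ψ) {p : ℝ[X]} (hp : NonnegCoeff p) :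
    expand ℝ 2 (evenPart Ψ p) = Ψ (expand ℝ 2 p) := by
  ext n
  rw [coeff_expand two_pos, evenPart]
  split_ifs with h
  · rw [coeff_contract two_ne_zero, Nat.div_mul_cancel h]
  · exact (S.coeff_zero (hp.expand two_pos) (by rw [coeff_expand two_pos, if_neg h])).symm

lemma evenPart_eq (S : SuppEndo Ψ) {p q : ℝ[X]} (hp : NonnegCoeff p)
    (h : Ψ (expand ℝ 2 p) = expand ℝ 2 q) : evenPart Ψ p = q :=
  expand_injective two_pos ((S.expand_evenPart hp).trans h)

lemma suppEndo_evenPart (S : SuppEndo Ψ) : SuppEndo (evenPart Ψ) where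
  map_mul p q hp hq := by
    apply S.evenPart_eq (hp.mul hq)
    rw [_root_.map_mul, _root_.map_mul, S.map_mul _ _ (hp.expand two_pos) (hq.expand two_pos),
      S.expand_evenPart hp, S.expand_evenPart hq]
  nonneg p hp n := by
    rw [evenPart, coeff_contract two_ne_zero]
    exact S.nonneg _ (hp.expand two_pos) _
  coeff_eq_zero_iff p hp n := by
    rw [evenPart, coeff_contract two_ne_zero, S.coeff_eq_zero_iff _ (hp.expand two_pos),
      coeff_expand_mul two_pos]
  leadingCoeff p hp := by
    rw [← leadingCoeff_expand two_pos, S.expand_evenPart hp,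
      S.leadingCoeff _ (hp.expand two_pos), leadingCoeff_expand two_pos]

lemma extendsTo_expand (S : SuppEndo Ψ) {q r : ℝ[X]} (h : ExtendsTo (evenPart Ψ) q r) :
    ExtendsTo Ψ (expand ℝ 2 q) (expand ℝ 2 r) := by
  obtain ⟨s, hs, hsq, e⟩ := h
  refine ⟨expand ℝ 2 s, hs.expand two_pos, ?_, ?_⟩
  · rw [← _root_.map_mul]; exact hsq.expand two_pos
  · rw [← _root_.map_mul, ← S.expand_evenPart hsq, e, _root_.map_mul, S.expand_evenPart hs]

/-- `Ψ` fixes the linear factors. -/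
def Normalized (Ψ : ℝ[X] → ℝ[X]) : Prop := ∀ a, 0 < a → Ψ (X + C a) = X + C a

lemma extendsTo_self_of_sq_lt (S : SuppEndo Ψ) (N : Normalized Ψ) {b c : ℝ} (hb : 0 < b)
    (h : b ^ 2 < c) : ExtendsTo Ψ (X ^ 2 - C b * X + C c) (X ^ 2 - C b * X + C c) := by
  have hd : b < c / b := by rw [lt_div_iff₀ hb]; linarith
  have := (S.extendsTo_quadratic hb hd (N b hb) (N _ (hb.trans hd))).2
  rwa [mul_div_cancel₀ _ hb.ne'] at this

lemma map_quadratic (S : SuppEndo Ψ) (N : Normalized Ψ) {b c : ℝ} (hb : 0 < b) (hc : 0 < c) :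
    Ψ (X ^ 2 + C b * X + C c) = X ^ 2 + C b * X + C c := by
  have hquad : ∀ e f : ℝ, X ^ 2 + C e * X + C f = quartic 0 0 1 e f := by
    intro e f; simp [quartic]
  have hmul : ∀ e f u v : ℝ, (X ^ 2 + C e * X + C f) * (X ^ 2 - C u * X + C v) =
      quartic 1 (e - u) (f + v - e * u) (e * v - f * u) (f * v) := by
    intro e f u v; simp [quartic]; ring
  have n := NonnegCoeff.quadratic hb hc
  have s : Ψ (X ^ 2 + C b * X + C c) = X ^ 2 + C ((Ψ (X ^ 2 + C b * X + C c)).coeff 1) * X +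
      C ((Ψ (X ^ 2 + C b * X + C c)).coeff 0) := by
    have n' := n
    rw [hquad] at n'
    rw [hquad, hquad]
    conv_lhs => rw [S.map_eq_quartic n' (natDegree_quartic_le _ _ _ _ _)]
    rw [S.coeff_zero n' (n := 4) (by simp), S.coeff_zero n' (n := 3) (by simp),
      S.coeff_natDegree_eq n' (natDegree_quartic_zero_zero_one _ _), coeff_quartic_two]
  generalize (Ψ (X ^ 2 + C b * X + C c)).coeff 1 = e at s
  generalize (Ψ (X ^ 2 + C b * X + C c)).coeff 0 = f at s
  have he : e = b := by
    have hE := S.extendsTo_self_of_sq_lt N hb (show b ^ 2 < b ^ 2 + c by linarith)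
    have n1 : NonnegCoeff ((X ^ 2 + C b * X + C c) * (X ^ 2 - C b * X + C (b ^ 2 + c))) := by
      rw [hmul]
      exact quartic_nonnegCoeff zero_le_one (by linarith) (by nlinarith)
        (by nlinarith [pow_pos hb 3]) (by positivity)
    have h := S.apply_mul_of_extendsTo hE n n1
    have z := S.coeff_zero n1 (n := 3) (by rw [hmul]; simp)
    rw [h, s, hmul, coeff_quartic_three] at z
    linarith
  have hf : f = c := by
    obtain ⟨t, ht0, ht⟩ : ∃ t : ℝ, 0 < t ∧ t * (c + b ^ 2) = c :=
      ⟨c / (c + b ^ 2), by positivity, by field_simp⟩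
    have ht1 : t < 1 := by
      by_contra! h
      nlinarith [mul_le_mul_of_nonneg_right h (show 0 ≤ c + b ^ 2 by positivity), pow_pos hb 2]
    have htc : t * b ^ 2 < c := by nlinarith [mul_pos ht0 hc]
    have hE := S.extendsTo_self_of_sq_lt N (mul_pos ht0 hb)
      (show (t * b) ^ 2 < t * c by nlinarith [mul_lt_mul_of_pos_left htc ht0])
    have n1 : NonnegCoeff ((X ^ 2 + C b * X + C c) *
        (X ^ 2 - C (t * b) * X + C (t * c))) := by
      rw [hmul]
      refine quartic_nonnegCoeff zero_le_one (by nlinarith) ?_ (by linarith) (by positivity)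
      nlinarith [mul_pos ht0 hc]
    have h := S.apply_mul_of_extendsTo hE n n1
    have z := S.coeff_zero n1 (n := 1) (by rw [hmul, coeff_quartic_one]; ring)
    rw [h, s, hmul, coeff_quartic_one, he] at z
    exact (mul_left_cancel₀ (mul_pos ht0 hb).ne' (by linarith)).symm
  rw [s, he, hf]

lemma expand_quadratic (b c : ℝ) :
    expand ℝ 2 (X ^ 2 - C (b ^ 2 - 2 * c) * X + C (c ^ 2)) =
      (X ^ 2 - C b * X + C c) * (X ^ 2 + C b * X + C c) := by
  simp only [map_add, map_sub, _root_.map_mul, map_pow, expand_C, expand_X, map_ofNat]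
  ring

lemma normalized_evenPart (S : SuppEndo Ψ) (N : Normalized Ψ) : Normalized (evenPart Ψ) := by
  have S₂ := S.suppEndo_evenPart
  obtain ⟨κ, hκ, h⟩ := S₂.exists_map_linear
  have hN : Normalized fun p => (evenPart Ψ p).scaleRoots κ⁻¹ := fun a ha => by
    simp only [h a ha, X_add_C_scaleRoots, mul_inv_cancel_right₀ hκ.ne']
  have h1 := (S₂.scaleRoots (inv_pos.mpr hκ)).map_quadratic hN (b := 3) (c := 4)
    (by norm_num) (by norm_num)
  have n : NonnegCoeff (X ^ 2 + C 3 * X + C 4) :=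
    NonnegCoeff.quadratic (by norm_num) (by norm_num)
  have h2 : evenPart Ψ (X ^ 2 + C 3 * X + C 4) = X ^ 2 + C 3 * X + C 4 := by
    apply S.evenPart_eq n
    have e : expand ℝ 2 (X ^ 2 + C 3 * X + C 4 : ℝ[X]) =
        (X ^ 2 + C 1 * X + C 2) * (X ^ 2 - C 1 * X + C 2) := by
      have := expand_quadratic 1 2
      norm_num [sub_eq_add_neg] at this ⊢
      rw [this]; ring
    have nq : NonnegCoeff (X ^ 2 + C 1 * X + C 2) := NonnegCoeff.quadratic one_pos two_pos
    have n2 := n.expand two_pos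
    rw [e] at n2 ⊢
    rw [S.apply_mul_of_extendsTo (S.extendsTo_self_of_sq_lt N one_pos (by norm_num)) nq n2,
      S.map_quadratic N one_pos two_pos]
  have hd : (X ^ 2 + C 3 * X + C 4 : ℝ[X]).natDegree = 2 := by compute_degree!
  have h3 := congrArg (coeff · 1) h1
  simp only [h2, coeff_scaleRoots, hd] at h3
  have hk : κ = 1 := by simpa using h3
  intro a ha
  rw [h a ha, hk, mul_one]

lemma extendsTo_self_of_nonpos (S : SuppEndo Ψ) (N : Normalized Ψ) {b c : ℝ} (hb : b ≤ 0)
    (hc : 0 < c) : ExtendsTo Ψ (X ^ 2 - C b * X + C c) (X ^ 2 - C b * X + C c) := by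
  rcases hb.lt_or_eq with hb | rfl
  · have h := S.extendsTo_self (NonnegCoeff.quadratic (neg_pos.mpr hb) hc)
    rw [S.map_quadratic N (neg_pos.mpr hb) hc] at h
    simpa [sub_eq_add_neg] using h
  · have n := NonnegCoeff.linear hc
    have h := S.extendsTo_self (n.expand two_pos)
    rw [← S.expand_evenPart n, S.normalized_evenPart N c hc] at h
    simpa using h

lemma extendsTo_self_of_evenPart (S : SuppEndo Ψ) (N : Normalized Ψ) {b c : ℝ} (hb : 0 < b)
    (hc : 0 < c) (h : ExtendsTo (evenPart Ψ) (X ^ 2 - C (b ^ 2 - 2 * c) * X + C (c ^ 2))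
      (X ^ 2 - C (b ^ 2 - 2 * c) * X + C (c ^ 2))) :
    ExtendsTo Ψ (X ^ 2 - C b * X + C c) (X ^ 2 - C b * X + C c) := by
  have h1 := S.extendsTo_expand h
  rw [expand_quadratic] at h1
  apply S.extendsTo_of_mul (NonnegCoeff.quadratic hb hc)
  rwa [S.map_quadratic N hb hc]

/-- Passing to even polynomials doubles the argument of the roots, so finitely many steps bring
them to the left half-plane. -/
lemma extendsTo_self_of_le (n : ℕ) {Ψ : ℝ[X] → ℝ[X]} (S : SuppEndo Ψ) (N : Normalized Ψ)
    {b c : ℝ} (hc : 0 < c) (h : 2 * c ≤ 2 ^ n * (4 * c - b ^ 2)) :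
    ExtendsTo Ψ (X ^ 2 - C b * X + C c) (X ^ 2 - C b * X + C c) := by
  induction n generalizing Ψ b c with
  | zero =>
    rcases le_or_gt b 0 with hb | hb
    · exact S.extendsTo_self_of_nonpos N hb hc
    · exact S.extendsTo_self_of_evenPart N hb hc (S.suppEndo_evenPart.extendsTo_self_of_nonpos
        (S.normalized_evenPart N) (by linarith) (by positivity))
  | succ n ih =>
    rcases le_or_gt b 0 with hb | hb
    · exact S.extendsTo_self_of_nonpos N hb hc
    apply S.extendsTo_self_of_evenPart N hb hc
    rcases le_or_gt (b ^ 2 - 2 * c) 0 with hB | hB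
    · exact S.suppEndo_evenPart.extendsTo_self_of_nonpos (S.normalized_evenPart N) hB
        (by positivity)
    · apply ih S.suppEndo_evenPart (S.normalized_evenPart N) (by positivity)
      have h0 : 0 < 4 * c - b ^ 2 := by
        by_contra! h0
        linarith [mul_nonpos_of_nonneg_of_nonpos (pow_nonneg zero_le_two (n + 1)) h0]
      have h1 : 4 * c ^ 2 - (b ^ 2 - 2 * c) ^ 2 = b ^ 2 * (4 * c - b ^ 2) := by ring
      rw [h1]
      calc 2 * c ^ 2 = c * (2 * c) := by ring
        _ ≤ c * (2 ^ (n + 1) * (4 * c - b ^ 2)) := by gcongr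
        _ = 2 ^ n * (2 * c * (4 * c - b ^ 2)) := by ring
        _ ≤ 2 ^ n * (b ^ 2 * (4 * c - b ^ 2)) := by gcongr; linarith

lemma extendsTo_self_of_discrim_neg (S : SuppEndo Ψ) (N : Normalized Ψ) {b c : ℝ}
    (h : b ^ 2 < 4 * c) : ExtendsTo Ψ (X ^ 2 - C b * X + C c) (X ^ 2 - C b * X + C c) := by
  obtain ⟨n, hn⟩ := pow_unbounded_of_one_lt (2 * c / (4 * c - b ^ 2)) (one_lt_two (α := ℝ))
  rw [div_lt_iff₀ (by linarith)] at hn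
  exact S.extendsTo_self_of_le n N (by nlinarith [sq_nonneg b]) hn.le

lemma extendsTo_self_of_monic (S : SuppEndo Ψ) (N : Normalized Ψ) {p : ℝ[X]} (hp : p.Monic)
    (h : ∀ x, 0 < x → p.eval x ≠ 0) : ExtendsTo Ψ p p := by
  induction hn : p.natDegree using Nat.strong_induction_on generalizing p with
  | _ n ih =>
  have aux : ∀ q r : ℝ[X], p = q * r → q.Monic → 0 < q.natDegree → ExtendsTo Ψ q q →
      ExtendsTo Ψ p p := by
    intro q r e hq hd hE
    have hr : r.Monic := hq.of_mul_monic_left (e ▸ hp)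
    have hdeg := hq.natDegree_mul hr
    rw [← e] at hdeg
    have := ih r.natDegree (by lia) hr
      (fun x hx h0 => h x hx (by rw [e, eval_mul, h0, mul_zero])) rfl
    rw [e]
    exact S.extendsTo_mul hE this
  rcases Nat.eq_zero_or_pos p.natDegree with h0 | h0
  · rw [hp.natDegree_eq_zero.mp h0]
    simpa [S.map_one] using S.extendsTo_self NonnegCoeff.one
  · obtain ⟨z, hz⟩ := IsAlgClosed.exists_aeval_eq_zero ℂ p
      (natDegree_pos_iff_degree_pos.mp h0).ne'
    by_cases him : z.im = 0
    · have hr : p.IsRoot z.re := by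
        have e : z = algebraMap ℝ ℂ z.re := Complex.ext (by simp) (by simp [him])
        rw [e, aeval_algebraMap_apply] at hz
        simpa using hz
      obtain ⟨r, e⟩ := dvd_iff_isRoot.mpr hr
      refine aux _ r e (monic_X_sub_C _) (by simp) ?_
      rcases lt_trichotomy z.re 0 with hlt | heq | hgt
      · have h1 := S.extendsTo_self (NonnegCoeff.linear (neg_pos.mpr hlt))
        rw [N _ (neg_pos.mpr hlt)] at h1
        simpa [sub_eq_add_neg] using h1
      · have h1 := S.extendsTo_self NonnegCoeff.var
        rw [S.map_X] at h1
        simpa [heq] using h1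
      · exact absurd hr (h _ hgt)
    · obtain ⟨r, e⟩ := p.quadratic_dvd_of_aeval_eq_zero_im_ne_zero hz him
      refine aux _ r e (by monicity!) ?_ (S.extendsTo_self_of_discrim_neg N ?_)
      · have hd : (X ^ 2 - C (2 * z.re) * X + C (‖z‖ ^ 2)).natDegree = 2 := by compute_degree!
        lia
      · rw [Complex.sq_norm, Complex.normSq_apply]
        have := mul_self_pos.mpr him
        nlinarith

lemma map_eq_self (S : SuppEndo Ψ) (N : Normalized Ψ) {p : ℝ[X]} (hp : NonnegCoeff p) :
    Ψ p = p := by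
  have hl := hp.leadingCoeff_pos
  have h1 := S.extendsTo_self_of_monic N (monic_mul_leadingCoeff_inv hp.1) (fun x hx => by
    rw [eval_mul, eval_C]
    exact (mul_pos (hp.eval_pos hx) (inv_pos.mpr hl)).ne')
  have h2 := S.extendsTo_self (NonnegCoeff.const hl)
  rw [S.map_C hl] at h2
  have h3 := S.extendsTo_mul h1 h2
  rw [mul_assoc, ← C_mul, inv_mul_cancel₀ hl.ne', C_1, mul_one] at h3
  exact S.apply_of_extendsTo h3 hp

/-- Every `SuppEndo` scales the roots by a positive constant. -/
theorem exists_eq_scaleRoots (S : SuppEndo Ψ) :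
    ∃ κ, 0 < κ ∧ ∀ p, NonnegCoeff p → Ψ p = p.scaleRoots κ := by
  obtain ⟨κ, hκ, h⟩ := S.exists_map_linear
  refine ⟨κ, hκ, fun p hp => ?_⟩
  have hN : Normalized fun p => (Ψ p).scaleRoots κ⁻¹ := fun a ha => by
    simp only [h a ha, X_add_C_scaleRoots, mul_inv_cancel_right₀ hκ.ne']
  have h1 := (S.scaleRoots (inv_pos.mpr hκ)).map_eq_self hN hp
  conv_rhs => rw [← h1, ← scaleRoots_mul, inv_mul_cancel₀ hκ.ne', scaleRoots_one]

end SuppEndo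

/-- The function on `ℤ` given by the coefficients of a polynomial. -/
noncomputable def intCoeff (p : ℝ[X]) (z : ℤ) : ℝ := if 0 ≤ z then p.coeff z.toNat else 0

/-- The generating polynomial of the restriction of `μ` to `ℕ`. -/
noncomputable def genPoly (μ : ℤ → ℝ) : ℝ[X] := ∑ᶠ n : ℕ, monomial n (μ n)

lemma coeff_genPoly {μ : ℤ → ℝ} (h : (Function.support μ).Finite) (n : ℕ) :
    (genPoly μ).coeff n = μ n := by
  have hf := h.preimage (Nat.cast_injective (R := ℤ)).injOn
  rw [genPoly, finsum_eq_sum_of_support_subset (s := hf.toFinset)]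
  · rw [finsetSum_coeff]
    simp only [coeff_monomial]
    rw [Finset.sum_ite_eq']
    simp only [Set.Finite.mem_toFinset, Set.mem_preimage, Function.mem_support]
    split_ifs with h
    · rfl
    · exact (not_not.mp h).symm
  · intro m hm
    simpa [monomial_eq_zero_iff] using hm

@[simp] lemma intCoeff_natCast (p : ℝ[X]) (n : ℕ) : intCoeff p n = p.coeff n := by
  simp [intCoeff]

lemma intCoeff_of_neg (p : ℝ[X]) {z : ℤ} (hz : z < 0) : intCoeff p z = 0 :=
  if_neg (not_le.mpr hz)

lemma support_intCoeff_subset (p : ℝ[X]) :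
    Function.support (intCoeff p) ⊆ (p.support.map Nat.castEmbedding : Finset ℤ) := by
  intro z hz
  rcases lt_or_ge z 0 with h | h
  · exact absurd (intCoeff_of_neg p h) hz
  · lift z to ℕ using h
    simpa using hz

lemma finite_support_intCoeff (p : ℝ[X]) : (Function.support (intCoeff p)).Finite :=
  (Finset.finite_toSet _).subset (support_intCoeff_subset p)

lemma finsum_intCoeff (p : ℝ[X]) : ∑ᶠ z, intCoeff p z = p.eval 1 := by
  rw [finsum_eq_sum_of_support_subset _ (support_intCoeff_subset p), Finset.sum_map,
    eval_eq_sum, sum]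
  simp

lemma convZ_intCoeff (p q : ℝ[X]) : convZ (intCoeff p) (intCoeff q) = intCoeff (p * q) := by
  ext z
  rcases lt_or_ge z 0 with h | h
  · rw [intCoeff_of_neg _ h, convZ]
    apply finsum_eq_zero_of_forall_eq_zero
    intro t
    rcases lt_or_ge t 0 with ht | ht
    · rw [intCoeff_of_neg _ ht, zero_mul]
    · rw [intCoeff_of_neg q (by lia : z - t < 0), mul_zero]
  · lift z to ℕ using h
    rw [intCoeff_natCast, coeff_mul, Finset.Nat.sum_antidiagonal_eq_sum_range_succ_mk, convZ,
      finsum_eq_sum_of_support_subset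
        (s := ((Finset.range z.succ).map Nat.castEmbedding : Finset ℤ)), Finset.sum_map]
    · refine Finset.sum_congr rfl fun k hk => ?_
      have hk' : k ≤ z := Nat.lt_succ_iff.mp (Finset.mem_range.mp hk)
      simp only [Nat.castEmbedding_apply]
      rw [← Nat.cast_sub hk', intCoeff_natCast, intCoeff_natCast]
    · intro t ht
      rw [Function.mem_support] at ht
      have h1 : 0 ≤ t := by
        by_contra! h
        exact ht (by rw [intCoeff_of_neg _ h, zero_mul])
      have h2 : t ≤ z := by
        by_contra! h
        exact ht (by rw [intCoeff_of_neg q (by lia : (z : ℤ) - t < 0), mul_zero])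
      lift t to ℕ using h1
      simpa [Nat.lt_succ_iff] using h2

lemma genPoly_intCoeff (p : ℝ[X]) : genPoly (intCoeff p) = p := by
  ext n; rw [coeff_genPoly (finite_support_intCoeff p), intCoeff_natCast]

lemma intCoeff_genPoly {μ : ℤ → ℝ} (h : (Function.support μ).Finite)
    (h0 : ∀ z < 0, μ z = 0) : intCoeff (genPoly μ) = μ := by
  ext z
  rcases lt_or_ge z 0 with hz | hz
  · rw [intCoeff_of_neg _ hz, h0 z hz]
  · lift z to ℕ using hz
    rw [intCoeff_natCast, coeff_genPoly h]

/-- The probability measure proportional to the coefficients of `p`. -/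
noncomputable def coeffLaw (p : ℝ[X]) : ℤ → ℝ := intCoeff (C (p.eval 1)⁻¹ * p)

lemma coeffLaw_mem {p : ℝ[X]} (hp : NonnegCoeff p) : coeffLaw p ∈ PZ := by
  have h := hp.eval_pos one_pos
  refine ⟨finite_support_intCoeff _, fun z => ?_, ?_⟩
  · rw [coeffLaw, intCoeff, coeff_C_mul]
    split_ifs
    · exact mul_nonneg (inv_pos.mpr h).le (hp.2 _)
    · exact le_rfl
  · rw [coeffLaw, finsum_intCoeff, eval_mul, eval_C, inv_mul_cancel₀ h.ne']

lemma coeffLaw_mul (p q : ℝ[X]) : coeffLaw (p * q) = convZ (coeffLaw p) (coeffLaw q) := by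
  rw [coeffLaw, coeffLaw, coeffLaw, convZ_intCoeff, eval_mul, mul_inv, C_mul, mul_mul_mul_comm]

lemma coeffLaw_natCast_eq_zero_iff {p : ℝ[X]} (hp : NonnegCoeff p) (n : ℕ) :
    coeffLaw p n = 0 ↔ p.coeff n = 0 := by
  simp [coeffLaw, (hp.eval_pos one_pos).ne']

lemma convZ_single (k : ℤ) (μ : ℤ → ℝ) (z : ℤ) : convZ (Pi.single k 1) μ z = μ (z - k) := by
  rw [convZ, finsum_eq_single _ k fun t ht => by simp [ht]]
  simp

lemma single_mem (k : ℤ) : (Pi.single k 1 : ℤ → ℝ) ∈ PZ := by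
  refine ⟨(Set.finite_singleton k).subset Pi.support_single_subset, fun z => ?_, ?_⟩
  · by_cases h : z = k
    · subst h; simp
    · simp [h]
  · rw [finsum_eq_single _ k fun t ht => by simp [ht]]
    simp

section Endomorphism

variable {Φ : (ℤ → ℝ) → (ℤ → ℝ)} (hmap : ∀ μ ∈ PZ, Φ μ ∈ PZ)
  (hsupp : ∀ μ ∈ PZ, Function.support (Φ μ) = Function.support μ)
  (hconv : ∀ μ ∈ PZ, ∀ ν ∈ PZ, Φ (convZ μ ν) = convZ (Φ μ) (Φ ν))

include hsupp in
lemma apply_eq_zero_iff {μ : ℤ → ℝ} (hμ : μ ∈ PZ) (z : ℤ) : Φ μ z = 0 ↔ μ z = 0 := by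
  have := Set.ext_iff.mp (hsupp μ hμ) z
  simpa [not_iff_not] using this

include hmap hsupp in
lemma map_single (k : ℤ) : Φ (Pi.single k 1) = Pi.single k 1 := by
  have h := single_mem k
  have h0 : ∀ z, z ≠ k → Φ (Pi.single k 1) z = 0 := fun z hz =>
    (apply_eq_zero_iff hsupp h z).mpr (by simp [hz])
  have h1 := (hmap _ h).2.2
  rw [finsum_eq_single _ k h0] at h1
  ext z
  by_cases hz : z = k
  · subst hz; simpa using h1
  · rw [h0 z hz]; simp [hz]

include hmap hsupp hconv in
lemma map_shift {μ : ℤ → ℝ} (hμ : μ ∈ PZ) (k z : ℤ) :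
    Φ (fun z => μ (z - k)) z = Φ μ (z - k) := by
  have h := hconv _ (single_mem k) μ hμ
  rw [map_single hmap hsupp] at h
  rw [← convZ_single k (Φ μ), ← h]
  congr 2
  ext z
  rw [convZ_single]

include hmap hsupp in
lemma genPoly_map_nonnegCoeff {p : ℝ[X]} (hp : NonnegCoeff p) :
    NonnegCoeff (genPoly (Φ (coeffLaw p))) := by
  have hm := hmap _ (coeffLaw_mem hp)
  refine ⟨fun h => ?_, fun n => by rw [coeff_genPoly hm.1]; exact hm.2.1 _⟩
  have h1 := congrArg (coeff · p.natDegree) h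
  simp only [coeff_genPoly hm.1, Polynomial.coeff_zero,
    apply_eq_zero_iff hsupp (coeffLaw_mem hp), coeffLaw_natCast_eq_zero_iff hp] at h1
  exact hp.leadingCoeff_pos.ne' h1

include hmap hsupp hconv in
lemma genPoly_map_mul {p q : ℝ[X]} (hp : NonnegCoeff p) (hq : NonnegCoeff q) :
    genPoly (Φ (coeffLaw (p * q))) = genPoly (Φ (coeffLaw p)) * genPoly (Φ (coeffLaw q)) := by
  have key : ∀ {p : ℝ[X]}, NonnegCoeff p → intCoeff (genPoly (Φ (coeffLaw p))) =
      Φ (coeffLaw p) := fun hp =>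
    intCoeff_genPoly (hmap _ (coeffLaw_mem hp)).1 fun z hz =>
      (apply_eq_zero_iff hsupp (coeffLaw_mem hp) z).mpr (intCoeff_of_neg _ hz)
  rw [coeffLaw_mul, hconv _ (coeffLaw_mem hp) _ (coeffLaw_mem hq), ← key hp, ← key hq,
    convZ_intCoeff, genPoly_intCoeff, genPoly_intCoeff, genPoly_intCoeff]

include hmap hsupp hconv in
lemma suppEndo_of_endomorphism :
    SuppEndo fun p => C (p.leadingCoeff / (genPoly (Φ (coeffLaw p))).leadingCoeff) *
      genPoly (Φ (coeffLaw p)) where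
  map_mul p q hp hq := by
    simp only [genPoly_map_mul hmap hsupp hconv hp hq, leadingCoeff_mul]
    rw [mul_div_mul_comm, C_mul, mul_mul_mul_comm]
  nonneg p hp n := by
    have h := genPoly_map_nonnegCoeff hmap hsupp hp
    rw [coeff_C_mul]
    exact mul_nonneg (div_pos hp.leadingCoeff_pos h.leadingCoeff_pos).le (h.2 n)
  coeff_eq_zero_iff p hp n := by
    have h := genPoly_map_nonnegCoeff hmap hsupp hp
    rw [coeff_C_mul, mul_eq_zero_iff_left
      (div_pos hp.leadingCoeff_pos h.leadingCoeff_pos).ne',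
      coeff_genPoly (hmap _ (coeffLaw_mem hp)).1,
      apply_eq_zero_iff hsupp (coeffLaw_mem hp), coeffLaw_natCast_eq_zero_iff hp]
  leadingCoeff p hp := by
    have h := genPoly_map_nonnegCoeff hmap hsupp hp
    rw [leadingCoeff_mul, leadingCoeff_C, div_mul_cancel₀ _ h.leadingCoeff_pos.ne']

include hmap hsupp hconv in
lemma exists_forall_proportional : ∃ β : ℝ, ∀ μ ∈ PZ, (∀ z < 0, μ z = 0) →
    ∃ K : ℝ, ∀ z : ℤ, Φ μ z = K * (μ z * Real.exp (-β * z)) := by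
  obtain ⟨κ, hκ, h⟩ := (suppEndo_of_endomorphism hmap hsupp hconv).exists_eq_scaleRoots
  refine ⟨Real.log κ, fun μ hμ h0 => ?_⟩
  have hμp := intCoeff_genPoly hμ.1 h0
  have h1 : (genPoly μ).eval 1 = 1 := by rw [← finsum_intCoeff, hμp, hμ.2.2]
  have hp : NonnegCoeff (genPoly μ) :=
    ⟨fun h => by simp [h] at h1, fun n => by rw [coeff_genPoly hμ.1]; exact hμ.2.1 n⟩
  have hlaw : coeffLaw (genPoly μ) = μ := by rw [coeffLaw, h1]; simpa using hμp
  have hg := genPoly_map_nonnegCoeff hmap hsupp hp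
  have hc : 0 < (genPoly μ).leadingCoeff / (genPoly (Φ (coeffLaw (genPoly μ)))).leadingCoeff :=
    div_pos hp.leadingCoeff_pos hg.leadingCoeff_pos
  have h2 := h _ hp
  simp only [hlaw] at h2 hc
  generalize (genPoly μ).leadingCoeff / (genPoly (Φ μ)).leadingCoeff = c at h2 hc
  refine ⟨c⁻¹ * κ ^ (genPoly μ).natDegree, fun z => ?_⟩
  by_cases hz : μ z = 0
  · rw [(apply_eq_zero_iff hsupp hμ z).mpr hz, hz]; simp
  have hz0 : 0 ≤ z := by
    by_contra! hneg
    exact hz (h0 z hneg)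
  lift z to ℕ using hz0
  have hle : z ≤ (genPoly μ).natDegree :=
    le_natDegree_of_ne_zero (by rwa [coeff_genPoly hμ.1])
  have h3 := congrArg (coeff · z) h2
  simp only [coeff_C_mul, coeff_scaleRoots, coeff_genPoly hμ.1,
    coeff_genPoly (hmap μ hμ).1] at h3
  have hexp : Real.exp (-Real.log κ * (z : ℤ)) = (κ ^ z)⁻¹ := by
    rw [Int.cast_natCast, neg_mul, Real.exp_neg, mul_comm, Real.exp_nat_mul, Real.exp_log hκ]
  rw [hexp, show Φ μ z = c⁻¹ * (c * Φ μ z) by field_simp, h3, pow_sub₀ _ hκ.ne' hle]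
  ring

end Endomorphism

theorem stmt_2 (Φ : (ℤ → ℝ) → (ℤ → ℝ))
    (hmap : ∀ μ ∈ PZ, Φ μ ∈ PZ)
    (hsupp : ∀ μ ∈ PZ, Function.support (Φ μ) = Function.support μ)
    (hconv : ∀ μ ∈ PZ, ∀ ν ∈ PZ, Φ (convZ μ ν) = convZ (Φ μ) (Φ ν)) :
    ∃ β : ℝ, ∀ μ ∈ PZ, ∀ z : ℤ,
      Φ μ z = μ z * Real.exp (-β * z) / ∑ᶠ y : ℤ, μ y * Real.exp (-β * y) := by
  obtain ⟨β, hβ⟩ := exists_forall_proportional hmap hsupp hconv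
  refine ⟨β, fun μ hμ => ?_⟩
  obtain ⟨L, hL⟩ : ∃ L : ℝ, ∀ z : ℤ, Φ μ z = L * (μ z * Real.exp (-β * z)) := by
    obtain ⟨m, hm⟩ := hμ.1.bddBelow
    have hshift : (fun z => μ (z - -m)) ∈ PZ := by
      have e : (fun z => μ (z - -m)) = μ ∘ Equiv.addRight m := by ext z; simp
      refine ⟨?_, fun z => hμ.2.1 _, ?_⟩
      · rw [e, Function.support_comp_eq_preimage]
        exact hμ.1.preimage (Equiv.addRight m).injective.injOn
      · rw [← hμ.2.2, e]
        exact finsum_comp_equiv (Equiv.addRight m)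
    obtain ⟨K, hK⟩ := hβ _ hshift fun z hz => by
      by_contra h
      have := hm (Function.mem_support.mpr h)
      lia
    refine ⟨K * Real.exp (β * m), fun z => ?_⟩
    have h := hK (z - m)
    rw [map_shift hmap hsupp hconv hμ] at h
    simp only [sub_neg_eq_add, sub_add_cancel] at h
    rw [h, show -β * ((z - m : ℤ) : ℝ) = β * m + -β * z by push_cast; ring, Real.exp_add]
    ring
  have hsum : 1 = L * ∑ᶠ y : ℤ, μ y * Real.exp (-β * y) := by
    rw [← (hmap μ hμ).2.2, mul_finsum]
    exact finsum_congr hL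
  intro z
  have hne : ∑ᶠ y : ℤ, μ y * Real.exp (-β * y) ≠ 0 := right_ne_zero_of_mul (hsum ▸ one_ne_zero)
  rw [hL z, eq_div_iff hne, mul_right_comm, ← hsum, one_mul]
end

section
/- (Poincaré) For every p ∈ ℳ there exists r ∈ 𝒫 such that the product p·r lies in 𝒫, i.e., p·r has nonnegative coefficients. -/
open Polynomial

/-- `Mset` is the set of real polynomials `p` with `p(1) = 1` that are positive on the
positive reals. -/
def Mset : Set (Polynomial ℝ) := {p | p.eval 1 = 1 ∧ ∀ x : ℝ, 0 < x → 0 < p.eval x}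

/-- All coefficients of the real polynomial `p` are nonnegative. -/
def NonnegCoeffs (p : ℝ[X]) : Prop := ∀ k, 0 ≤ p.coeff k

namespace NonnegCoeffs

theorem mul {p q : ℝ[X]} (hp : NonnegCoeffs p) (hq : NonnegCoeffs q) : NonnegCoeffs (p * q) := by
  intro k
  rw [coeff_mul]
  exact Finset.sum_nonneg fun i _ => mul_nonneg (hp _) (hq _)

theorem add {p q : ℝ[X]} (hp : NonnegCoeffs p) (hq : NonnegCoeffs q) : NonnegCoeffs (p + q) := by
  intro k
  rw [coeff_add]
  exact add_nonneg (hp k) (hq k)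

theorem const {a : ℝ} (ha : 0 ≤ a) : NonnegCoeffs (C a) := by
  intro k
  rw [coeff_C]
  split_ifs <;> simp [ha]

theorem var : NonnegCoeffs (X : ℝ[X]) := by
  intro k
  rw [coeff_X]
  split_ifs <;> simp

theorem one : NonnegCoeffs (1 : ℝ[X]) := const zero_le_one

theorem expand {p : ℝ[X]} (hp : NonnegCoeffs p) {n : ℕ} (hn : 0 < n) :
    NonnegCoeffs (Polynomial.expand ℝ n p) := by
  intro k
  rw [coeff_expand hn]
  split_ifs
  exacts [hp _, le_rfl]

theorem quadratic {b c : ℝ} (hb : 0 ≤ b) (hc : 0 ≤ c) :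
    NonnegCoeffs (X * X + C b * X + C c) :=
  ((var.mul var).add ((const hb).mul var)).add (const hc)

theorem eval_one_pos {p : ℝ[X]} (hp : NonnegCoeffs p) (h0 : p ≠ 0) : 0 < p.eval 1 := by
  rw [eval_eq_sum, Polynomial.sum]
  refine Finset.sum_pos (fun i hi => ?_) (nonempty_support_iff.2 h0)
  simpa using lt_of_le_of_ne (hp i) (mem_support_iff.1 hi).symm

end NonnegCoeffs

theorem quadratic_ne_zero (b c : ℝ) : (X * X + C b * X + C c : ℝ[X]) ≠ 0 := by
  intro h
  have h2 := congrArg (fun p => coeff p 2) h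
  simp [coeff_X] at h2

/-- A multiplier for a monic quadratic `q` is obtained by repeatedly passing to `q(x) q(-x)`,
which is again a monic quadratic in `x ^ 2`; each step doubles the normalized discriminant. -/
theorem exists_multiplier_quadratic (n : ℕ) :
    ∀ b c : ℝ, 0 < c → 4 * c ≤ 2 ^ n * (4 * c - b ^ 2) →
      ∃ r : ℝ[X], r ≠ 0 ∧ NonnegCoeffs r ∧ NonnegCoeffs ((X * X + C b * X + C c) * r) := by
  induction n with
  | zero =>
    intro b c hc h
    have hb : b = 0 := by
      have : b ^ 2 ≤ 0 := by linarith
      exact pow_eq_zero_iff two_ne_zero |>.1 (le_antisymm this (sq_nonneg b))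
    refine ⟨1, one_ne_zero, .one, ?_⟩
    rw [mul_one]
    exact .quadratic hb.ge hc.le
  | succ n ih =>
    intro b c hc h
    rcases le_or_gt 0 b with hb | hb
    · refine ⟨1, one_ne_zero, .one, ?_⟩
      rw [mul_one]
      exact .quadratic hb hc.le
    obtain ⟨r, hr0, hr, hqr⟩ : ∃ r : ℝ[X], r ≠ 0 ∧ NonnegCoeffs r ∧
        NonnegCoeffs ((X * X + C (2 * c - b ^ 2) * X + C (c ^ 2)) * r) := by
      rcases le_total (b ^ 2) (2 * c) with hbc | hbc
      · refine ⟨1, one_ne_zero, .one, ?_⟩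
        rw [mul_one]
        exact .quadratic (by linarith) (by positivity)
      · refine ih _ _ (by positivity) ?_
        have hpos : 0 ≤ 2 ^ n * (4 * c - b ^ 2) := by
          rw [pow_succ] at h
          nlinarith
        calc 4 * c ^ 2 = c * (4 * c) := by ring
          _ ≤ c * (2 ^ (n + 1) * (4 * c - b ^ 2)) := by gcongr
          _ = 2 * c * (2 ^ n * (4 * c - b ^ 2)) := by ring
          _ ≤ b ^ 2 * (2 ^ n * (4 * c - b ^ 2)) := by gcongr
          _ = 2 ^ n * (4 * c ^ 2 - (2 * c - b ^ 2) ^ 2) := by ring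
    refine ⟨(X * X + C (-b) * X + C c) * expand ℝ 2 r,
      mul_ne_zero (quadratic_ne_zero _ _) ((expand_ne_zero two_pos).2 hr0),
      (NonnegCoeffs.quadratic (by linarith) hc.le).mul (hr.expand two_pos), ?_⟩
    convert hqr.expand two_pos using 1
    simp only [map_mul, map_add, map_sub, map_neg, map_pow, expand_X, expand_C]
    simp only [map_ofNat]
    ring

theorem Irreducible.exists_multiplier {f : ℝ[X]} (hf : Irreducible f)
    (hroot : ∀ x : ℝ, 0 < x → f.eval x ≠ 0) :
    ∃ (e : ℝ) (r : ℝ[X]), e ≠ 0 ∧ r ≠ 0 ∧ NonnegCoeffs r ∧ NonnegCoeffs (C e * f * r) := by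
  have hdeg : f.natDegree ≤ 2 := hf.natDegree_le_two
  have hpos : 0 < f.natDegree := hf.natDegree_pos
  obtain h1 | h2 : f.natDegree = 1 ∨ f.natDegree = 2 := by lia
  · obtain ⟨a, ha, b, rfl⟩ := natDegree_eq_one.1 h1
    have hab : 0 ≤ a * b := by
      by_contra! hlt
      refine hroot (-b / a) ?_ ?_
      · have : -b / a = -(a * b) / a ^ 2 := by field_simp
        rw [this]
        have := sq_pos_of_ne_zero ha
        apply div_pos <;> linarith
      · simp
        field_simp
        ring
    refine ⟨a, 1, ha, one_ne_zero, .one, ?_⟩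
    have : C a * (C a * X + C b) * 1 = C (a * a) * X + C (a * b) := by
      simp only [map_mul]
      ring
    rw [this]
    exact ((NonnegCoeffs.const (mul_self_nonneg a)).mul .var).add (.const hab)
  · have ha : f.coeff 2 ≠ 0 := by
      rw [← h2]
      exact leadingCoeff_ne_zero.2 hf.ne_zero
    set a := f.coeff 2
    set b := f.coeff 1 / a
    set c := f.coeff 0 / a
    have hfe : C a⁻¹ * f = X * X + C b * X + C c := by
      have : f = C a * (X * X + C b * X + C c) := by
        conv_lhs => rw [f.as_sum_range_C_mul_X_pow, h2]
        simp only [Finset.sum_range_succ, Finset.sum_range_zero]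
        have hb : f.coeff 1 = a * b := by simp only [b]; field_simp
        have hc : f.coeff 0 = a * c := by simp only [c]; field_simp
        rw [hb, hc]
        simp only [map_mul]
        ring
      conv_lhs => rw [this]
      rw [← mul_assoc, ← C_mul, inv_mul_cancel₀ ha, C_1, one_mul]
    have hdisc : 0 < 4 * c - b ^ 2 := by
      by_contra! hle
      have hs := Real.sq_sqrt (show 0 ≤ b ^ 2 - 4 * c by linarith)
      have he := congrArg (eval ((-b + √(b ^ 2 - 4 * c)) / 2)) hfe
      refine hf.not_isRoot_of_natDegree_ne_one (by lia)
        (x := (-b + √(b ^ 2 - 4 * c)) / 2) ?_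
      simp only [eval_mul, eval_add, eval_C, eval_X] at he
      refine (mul_eq_zero.1 (he.trans ?_)).resolve_left (inv_ne_zero ha)
      linear_combination hs / 4
    have hc : 0 < c := by nlinarith [sq_nonneg b]
    obtain ⟨n, hn⟩ := pow_unbounded_of_one_lt (4 * c / (4 * c - b ^ 2)) one_lt_two
    obtain ⟨r, hr0, hr, hqr⟩ :=
      exists_multiplier_quadratic n b c hc ((div_le_iff₀ hdisc).1 hn.le)
    exact ⟨a⁻¹, r, inv_ne_zero ha, hr0, hr, by rwa [hfe]⟩

theorem exists_multiplier_of_no_pos_root (p : ℝ[X]) (hroot : ∀ x : ℝ, 0 < x → p.eval x ≠ 0) :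
    ∃ (e : ℝ) (r : ℝ[X]), e ≠ 0 ∧ r ≠ 0 ∧ NonnegCoeffs r ∧ NonnegCoeffs (C e * p * r) := by
  induction p using WfDvdMonoid.induction_on_irreducible with
  | zero => exact absurd eval_zero (hroot 1 one_pos)
  | unit u hu =>
    obtain ⟨a, ha, rfl⟩ := Polynomial.isUnit_iff.1 hu
    refine ⟨a, 1, ha.ne_zero, one_ne_zero, .one, ?_⟩
    rw [mul_one, ← C_mul]
    exact .const (mul_self_nonneg a)
  | mul g f _ hf ih =>
    simp only [eval_mul] at hroot
    obtain ⟨d, s, hd, hs0, hs, hgs⟩ := ih fun x hx => right_ne_zero_of_mul (hroot x hx)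
    obtain ⟨e, r, he, hr0, hr, hfr⟩ :=
      hf.exists_multiplier fun x hx => left_ne_zero_of_mul (hroot x hx)
    refine ⟨e * d, r * s, mul_ne_zero he hd, mul_ne_zero hr0 hs0, hr.mul hs, ?_⟩
    convert hfr.mul hgs using 1
    rw [C_mul]
    ring

theorem stmt_4 (p : Polynomial ℝ) (hp : p ∈ Mset) :
    ∃ r ∈ Pset, p * r ∈ Pset := by
  obtain ⟨hp1, hpos⟩ := hp
  obtain ⟨e, r, he, hr0, hr, hpr⟩ :=
    exists_multiplier_of_no_pos_root p fun x hx => (hpos x hx).ne'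
  have hp0 : p ≠ 0 := by
    rintro rfl
    simp at hp1
  have hr1 := hr.eval_one_pos hr0
  have hepos : 0 < e := by
    have h := hpr.eval_one_pos (mul_ne_zero (mul_ne_zero (C_ne_zero.2 he) hp0) hr0)
    simp only [eval_mul, eval_C, hp1, mul_one] at h
    exact pos_of_mul_pos_left h hr1.le
  have hs1 : (C (r.eval 1)⁻¹ * r).eval 1 = 1 := by
    rw [eval_mul, eval_C, inv_mul_cancel₀ hr1.ne']
  refine ⟨C (r.eval 1)⁻¹ * r, ⟨(NonnegCoeffs.const (inv_nonneg.2 hr1.le)).mul hr, hs1⟩, ?_, ?_⟩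
  · have h : p * (C (r.eval 1)⁻¹ * r) = C (r.eval 1)⁻¹ * C e⁻¹ * (C e * p * r) := by
      have hce : (C e⁻¹ * C e : ℝ[X]) = 1 := by rw [← C_mul, inv_mul_cancel₀ he, C_1]
      linear_combination (-(C (r.eval 1)⁻¹ * p * r)) * hce
    rw [h]
    exact ((NonnegCoeffs.const (inv_nonneg.2 hr1.le)).mul (.const (inv_nonneg.2 hepos.le))).mul hpr
  · rw [eval_mul, hp1, hs1, one_mul]
end
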